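/- arXiv:2209.09600 — 2 statements merged into one kernel-verified Lean document; each statement's English description precedes it below -/
import Mathlib

section
/- (Explicit coupled 3D MHD solution with large velocity.) Let ν ≥ 0, η ≥ 0, M ∈ ℝ and let N be a nonzero integer, and define B₀ : 𝕋³ → ℝ³ by B₀(x) = (2π)^{−3/2}(sin(N x₃), cos(N x₃), 0). Then the pair u(t,x) = M e^{−νN²t} B₀(x), b(t,x) = M e^{−ηN²t} B₀(x), together with the pressure P(t,x) = (M²/2)(e^{−2νN²t} − e^{−2ηN²t})|B₀(x)|², is a global smooth solution of the MHD system on 𝕋³ with initial datum (M B₀, M B₀). -/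
open MeasureTheory Real Set

noncomputable section

/-- Partial derivative of a scalar function on `ℝ^d` in the `i`-th coordinate direction. -/
def pd {d : ℕ} (i : Fin d) (f : (Fin d → ℝ) → ℝ) : (Fin d → ℝ) → ℝ :=
  fun x => fderiv ℝ f x (Pi.single i 1)

/-- Iterated partial derivative along a list of directions. -/
def pdList {d : ℕ} : List (Fin d) → ((Fin d → ℝ) → ℝ) → ((Fin d → ℝ) → ℝ)
  | [], f => f
  | i :: l, f => pd i (pdList l f)

/-- The list of directions associated to a multi-index `α`
(the direction `i` repeated `α i` times). -/
def mIdxList {d : ℕ} (α : Fin d → ℕ) : List (Fin d) :=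
  ((List.finRange d).map fun i => List.replicate (α i) i).flatten

/-- The partial derivative `∂^α f` for a multi-index `α`. -/
def pdM {d : ℕ} (α : Fin d → ℕ) (f : (Fin d → ℝ) → ℝ) : (Fin d → ℝ) → ℝ :=
  pdList (mIdxList α) f

/-- `|∇^m w|²(x) = ∑_{|α| = m} |∂^α w(x)|²` for a vector field `w : ℝ^d → ℝ^k`. -/
def gradSq {d k : ℕ} (m : ℕ) (w : (Fin d → ℝ) → Fin k → ℝ) (x : Fin d → ℝ) : ℝ :=
  ∑ α ∈ Finset.Nat.antidiagonalTuple d m, ∑ i, pdM α (fun y => w y i) x ^ 2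

/-- The fundamental domain `[0,L]^d` of the torus `ℝ^d/(Lℤ)^d`. -/
def box (d : ℕ) (L : ℝ) : Set (Fin d → ℝ) := Set.Icc 0 fun _ => L

/-- Square of the Sobolev `H^r` norm on the torus of period `L`. -/
def HnormSq {d k : ℕ} (L : ℝ) (r : ℕ) (w : (Fin d → ℝ) → Fin k → ℝ) : ℝ :=
  ∑ m ∈ Finset.range (r + 1), ∫ x in box d L, gradSq m w x

/-- The Sobolev `H^r` norm on the torus of period `L`. -/
def Hnorm {d k : ℕ} (L : ℝ) (r : ℕ) (w : (Fin d → ℝ) → Fin k → ℝ) : ℝ :=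
  Real.sqrt (HnormSq L r w)

/-- The `L²` norm on the torus of period `L`. -/
def L2norm {d k : ℕ} (L : ℝ) (w : (Fin d → ℝ) → Fin k → ℝ) : ℝ :=
  Real.sqrt (∫ x in box d L, ∑ i, w x i ^ 2)

/-- The `L^∞` norm of `∇^m w`. -/
def LinfGrad {d k : ℕ} (m : ℕ) (w : (Fin d → ℝ) → Fin k → ℝ) : ℝ :=
  ⨆ x : Fin d → ℝ, Real.sqrt (gradSq m w x)

/-- The `L^∞` norm of `w`. -/
def Linf {d k : ℕ} (w : (Fin d → ℝ) → Fin k → ℝ) : ℝ := LinfGrad 0 w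

/-- `L`-periodicity in each coordinate direction. -/
def Prdc {d : ℕ} {E : Type*} (L : ℝ) (w : (Fin d → ℝ) → E) : Prop :=
  ∀ (x : Fin d → ℝ) (i : Fin d), w (x + Pi.single i L) = w x

/-- Zero average on the torus. -/
def ZeroAvg {d k : ℕ} (L : ℝ) (w : (Fin d → ℝ) → Fin k → ℝ) : Prop :=
  ∀ i, (∫ x in box d L, w x i) = 0

/-- Divergence of a vector field on `ℝ^d`. -/
def divg {d : ℕ} (w : (Fin d → ℝ) → Fin d → ℝ) (x : Fin d → ℝ) : ℝ :=
  ∑ i, pd i (fun y => w y i) x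

/-- A smooth solution of the MHD system with viscosity `ν` and resistivity `η` on the torus
`ℝ^d/(Lℤ)^d`, on the time interval `J` (the equations are imposed at positive times of `J`). -/
structure IsMHD (d : ℕ) (L ν η : ℝ) (J : Set ℝ)
    (u b : ℝ → (Fin d → ℝ) → Fin d → ℝ) (P : ℝ → (Fin d → ℝ) → ℝ) : Prop where
  smooth_u : ContDiffOn ℝ (⊤ : ℕ∞) (fun p : ℝ × (Fin d → ℝ) => u p.1 p.2) (J ×ˢ Set.univ)
  smooth_b : ContDiffOn ℝ (⊤ : ℕ∞) (fun p : ℝ × (Fin d → ℝ) => b p.1 p.2) (J ×ˢ Set.univ)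
  smooth_P : ContDiffOn ℝ (⊤ : ℕ∞) (fun p : ℝ × (Fin d → ℝ) => P p.1 p.2) (J ×ˢ Set.univ)
  periodic_u : ∀ t ∈ J, Prdc L (u t)
  periodic_b : ∀ t ∈ J, Prdc L (b t)
  periodic_P : ∀ t ∈ J, Prdc L (P t)
  div_u : ∀ t ∈ J, ∀ x, divg (u t) x = 0
  div_b : ∀ t ∈ J, ∀ x, divg (b t) x = 0
  momentum : ∀ t ∈ J, 0 < t → ∀ x i,
    deriv (fun s => u s x i) t + (∑ j, u t x j * pd j (fun y => u t y i) x) + pd i (P t) x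
      = ν * (∑ j, pd j (pd j fun y => u t y i) x) + ∑ j, b t x j * pd j (fun y => b t y i) x
  induction_eq : ∀ t ∈ J, 0 < t → ∀ x i,
    deriv (fun s => b s x i) t + (∑ j, u t x j * pd j (fun y => b t y i) x)
      = (∑ j, b t x j * pd j (fun y => u t y i) x)
        + η * (∑ j, pd j (pd j fun y => b t y i) x)

/-- Projection from `ℝ^d` onto the torus `ℝ^d/(Lℤ)^d`. -/
def torusProj (d : ℕ) (L : ℝ) (x : Fin d → ℝ) : Fin d → AddCircle L :=
  fun i => (x i : AddCircle L)

/-- A magnetic line of the field `b`: the image on the torus of a maximal (hence, since the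
relevant fields are smooth and periodic, globally defined) integral curve of `b`. -/
def IsMagLine (d : ℕ) (L : ℝ) (b : (Fin d → ℝ) → Fin d → ℝ)
    (s : Set (Fin d → AddCircle L)) : Prop :=
  ∃ γ : ℝ → Fin d → ℝ, (∀ τ : ℝ, HasDerivAt γ (b (γ τ)) τ) ∧
    s = torusProj d L '' Set.range γ

/-- The families of magnetic lines of `b₁` and `b₂` are topologically equivalent: some
self-homeomorphism of the torus maps the family of magnetic lines of `b₁` bijectively onto the
family of magnetic lines of `b₂`. -/
def MagLinesEquiv (d : ℕ) (L : ℝ) (b₁ b₂ : (Fin d → ℝ) → Fin d → ℝ) : Prop :=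
  ∃ φ : (Fin d → AddCircle L) ≃ₜ (Fin d → AddCircle L),
    ∀ s : Set (Fin d → AddCircle L), IsMagLine d L b₁ s ↔ IsMagLine d L b₂ (φ '' s)


/-- The Beltrami field `B₀(x) = (2π)^{-3/2} (sin(N x₃), cos(N x₃), 0)` on the `2π`-torus. -/
def Belt0 (N : ℤ) : (Fin 3 → ℝ) → Fin 3 → ℝ := fun x =>
  ((2 * π) ^ (-(3 : ℝ) / 2)) •
    ![Real.sin ((N : ℝ) * x 2), Real.cos ((N : ℝ) * x 2), 0]

/-- Partial derivatives of a function of a single coordinate. -/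
theorem pd_comp_coord {d : ℕ} (i j : Fin d) {g g' : ℝ → ℝ} (h : ∀ z, HasDerivAt g (g' z) z) :
    pd j (fun y => g (y i)) = fun x => if i = j then g' (x i) else 0 := by
  funext x
  have h1 : HasFDerivAt (fun y : Fin d → ℝ => y i)
      (ContinuousLinearMap.proj (R := ℝ) (φ := fun _ : Fin d => ℝ) i) x :=
    (ContinuousLinearMap.proj (R := ℝ) (φ := fun _ : Fin d => ℝ) i).hasFDerivAt
  have h2 := (h (x i)).comp_hasFDerivAt x h1
  have h3 : fderiv ℝ (fun y : Fin d → ℝ => g (y i)) x = _ := h2.fderiv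
  simp [pd, h3, Pi.single_apply]

theorem pd_const {d : ℕ} (j : Fin d) (a : ℝ) :
    pd j (fun _ => a) = fun _ => 0 := by
  funext x
  simp [pd]

theorem pd_const_mul_sin {d : ℕ} (i j : Fin d) (a k : ℝ) :
    pd j (fun y => a * Real.sin (k * y i))
      = fun x => if i = j then a * k * Real.cos (k * x i) else 0 := by
  refine pd_comp_coord i j (g := fun z => a * Real.sin (k * z))
    (g' := fun z => a * k * Real.cos (k * z)) fun z => ?_
  refine ((((hasDerivAt_id z).const_mul k).sin).const_mul a).congr_deriv ?_
  simp only [id]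
  ring

theorem pd_const_mul_cos {d : ℕ} (i j : Fin d) (a k : ℝ) :
    pd j (fun y => a * Real.cos (k * y i))
      = fun x => if i = j then -(a * k) * Real.sin (k * x i) else 0 := by
  refine pd_comp_coord i j (g := fun z => a * Real.cos (k * z))
    (g' := fun z => -(a * k) * Real.sin (k * z)) fun z => ?_
  refine ((((hasDerivAt_id z).const_mul k).cos).const_mul a).congr_deriv ?_
  simp only [id]
  ring

theorem smul_belt0_apply_zero (a : ℝ) (N : ℤ) (x : Fin 3 → ℝ) :
    (a • Belt0 N x) 0 = a * (2 * π) ^ (-(3 : ℝ) / 2) * Real.sin (N * x 2) := by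
  simp [Belt0, mul_assoc]

theorem smul_belt0_apply_one (a : ℝ) (N : ℤ) (x : Fin 3 → ℝ) :
    (a • Belt0 N x) 1 = a * (2 * π) ^ (-(3 : ℝ) / 2) * Real.cos (N * x 2) := by
  simp [Belt0, mul_assoc]

theorem smul_belt0_apply_two (a : ℝ) (N : ℤ) (x : Fin 3 → ℝ) :
    (a • Belt0 N x) 2 = 0 := by
  simp [Belt0]

theorem sum_sq_belt0 (N : ℤ) (x : Fin 3 → ℝ) :
    ∑ i, Belt0 N x i ^ 2 = ((2 * π) ^ (-(3 : ℝ) / 2)) ^ 2 := by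
  simp only [Belt0, Fin.sum_univ_three, Pi.smul_apply, smul_eq_mul, Matrix.cons_val]
  linear_combination (((2 * π) ^ (-(3 : ℝ) / 2)) ^ 2) * Real.sin_sq_add_cos_sq (N * x 2)

theorem contDiff_belt0 (N : ℤ) {n : WithTop ℕ∞} : ContDiff ℝ n (Belt0 N) := by
  unfold Belt0
  refine ContDiff.const_smul _ (contDiff_pi.2 fun i => ?_)
  fin_cases i
  · exact (contDiff_const.mul (contDiff_apply ℝ ℝ (2 : Fin 3))).sin
  · exact (contDiff_const.mul (contDiff_apply ℝ ℝ (2 : Fin 3))).cos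
  · exact contDiff_const

theorem prdc_belt0 (N : ℤ) : Prdc (2 * π) (Belt0 N) := by
  intro x i
  have h : ∃ m : ℤ, (N : ℝ) * (x + Pi.single i (2 * π) : Fin 3 → ℝ) 2 = N * x 2 + m * (2 * π) := by
    by_cases hi : i = 2
    · exact ⟨N, by subst hi; simp; ring⟩
    · exact ⟨0, by simp [Ne.symm hi]⟩
  obtain ⟨m, hm⟩ := h
  simp only [Belt0, hm, Real.sin_add_int_mul_two_pi, Real.cos_add_int_mul_two_pi]

theorem divg_smul_belt0 (a : ℝ) (N : ℤ) (x : Fin 3 → ℝ) :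
    divg (fun y => a • Belt0 N y) x = 0 := by
  simp [divg, Fin.sum_univ_three, -Pi.smul_apply, smul_belt0_apply_zero, smul_belt0_apply_one,
    smul_belt0_apply_two, pd_const_mul_sin, pd_const_mul_cos, pd_const]

/-- The nonlinear terms vanish: multiples of `B₀` are transported trivially along `B₀`. -/
theorem sum_smul_belt0_mul_pd (a c : ℝ) (N : ℤ) (x : Fin 3 → ℝ) (i : Fin 3) :
    ∑ j, (a • Belt0 N x) j * pd j (fun y => (c • Belt0 N y) i) x = 0 := by
  fin_cases i <;>
  simp [-Pi.smul_apply, smul_belt0_apply_zero, smul_belt0_apply_one,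
    smul_belt0_apply_two, pd_const_mul_sin, pd_const_mul_cos, pd_const]

/-- `B₀` is an eigenfunction of the Laplacian with eigenvalue `-N²`. -/
theorem sum_pd_pd_smul_belt0 (a : ℝ) (N : ℤ) (x : Fin 3 → ℝ) (i : Fin 3) :
    ∑ j, pd j (pd j fun y => (a • Belt0 N y) i) x = -(N : ℝ) ^ 2 * (a • Belt0 N x) i := by
  fin_cases i <;>
  simp [Fin.sum_univ_three, -Pi.smul_apply, smul_belt0_apply_zero, smul_belt0_apply_one,
    smul_belt0_apply_two, pd_const_mul_sin, pd_const_mul_cos, pd_const, -neg_mul] <;> ring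

theorem deriv_exp_smul_belt0 (M κ t : ℝ) (N : ℤ) (x : Fin 3 → ℝ) (i : Fin 3) :
    deriv (fun s => ((M * Real.exp (-κ * (N : ℝ) ^ 2 * s)) • Belt0 N x) i) t
      = κ * (-(N : ℝ) ^ 2 * ((M * Real.exp (-κ * (N : ℝ) ^ 2 * t)) • Belt0 N x) i) := by
  have h := ((((hasDerivAt_id t).const_mul (-κ * (N : ℝ) ^ 2)).exp).const_mul M).mul_const
    (Belt0 N x i)
  refine Eq.trans h.deriv ?_
  simp only [Pi.smul_apply, smul_eq_mul, id]
  ring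

theorem contDiff_exp_smul_belt0 (M κ : ℝ) (N : ℤ) {n : WithTop ℕ∞} :
    ContDiff ℝ n (fun p : ℝ × (Fin 3 → ℝ) =>
      (M * Real.exp (-κ * (N : ℝ) ^ 2 * p.1)) • Belt0 N p.2) :=
  (contDiff_const.mul (contDiff_const.mul contDiff_fst).exp).smul
    ((contDiff_belt0 N).comp contDiff_snd)

/-- explicit coupled 3D MHD solution with large velocity:
`u = M e^{-νN²t} B₀`, `b = M e^{-ηN²t} B₀` with pressure
`P = (M²/2)(e^{-2νN²t} - e^{-2ηN²t})|B₀|²` is a global smooth solution of the MHD system on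
the `2π`-torus with initial datum `(M B₀, M B₀)`. -/
theorem explicit_coupled_solution_3d (ν η M : ℝ) (hν : 0 ≤ ν) (hη : 0 ≤ η)
    (N : ℤ) (hN : N ≠ 0) :
    IsMHD 3 (2 * π) ν η (Set.Ici 0)
      (fun t x => (M * Real.exp (-ν * (N : ℝ) ^ 2 * t)) • Belt0 N x)
      (fun t x => (M * Real.exp (-η * (N : ℝ) ^ 2 * t)) • Belt0 N x)
      (fun t x => M ^ 2 / 2
        * (Real.exp (-(2 * ν) * (N : ℝ) ^ 2 * t) - Real.exp (-(2 * η) * (N : ℝ) ^ 2 * t))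
        * ∑ i, Belt0 N x i ^ 2) ∧
    (∀ x, (M * Real.exp (-ν * (N : ℝ) ^ 2 * 0)) • Belt0 N x = M • Belt0 N x) ∧
    (∀ x, (M * Real.exp (-η * (N : ℝ) ^ 2 * 0)) • Belt0 N x = M • Belt0 N x) := by
  refine ⟨?_, fun x => by simp, fun x => by simp⟩
  simp only [sum_sq_belt0]
  exact
    { smooth_u := (contDiff_exp_smul_belt0 M ν N).contDiffOn
      smooth_b := (contDiff_exp_smul_belt0 M η N).contDiffOn
      smooth_P := by
        refine ContDiff.contDiffOn ?_
        fun_prop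
      periodic_u := fun t _ x i => by simp only [prdc_belt0 N x i]
      periodic_b := fun t _ x i => by simp only [prdc_belt0 N x i]
      periodic_P := fun t _ x i => rfl
      div_u := fun t _ x => divg_smul_belt0 _ N x
      div_b := fun t _ x => divg_smul_belt0 _ N x
      momentum := fun t _ _ x i => by
        rw [deriv_exp_smul_belt0, sum_smul_belt0_mul_pd, sum_smul_belt0_mul_pd,
          sum_pd_pd_smul_belt0, pd_const]
        ring
      induction_eq := fun t _ _ x i => by
        rw [deriv_exp_smul_belt0, sum_smul_belt0_mul_pd, sum_smul_belt0_mul_pd,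
          sum_pd_pd_smul_belt0]
        ring }

end
end

section
/- (The initial field for 2D instantaneous reconnection.) Let M > 0 and ε ∈ (0,1), and define on 𝕋² the field b₀^ε(x₁,x₂) = M(−sin x₁ sin(x₂ − εx₁), −ε sin x₁ sin(x₂ − εx₁) − cos x₁ cos(x₂ − εx₁)) and the function ψ₀^ε(x₁,x₂) = M sin x₁ cos(x₂ − εx₁). Then: (i) b₀^ε = ∇⊥ψ₀^ε, where ∇⊥ψ = (∂₂ψ, −∂₁ψ); in particular div b₀^ε = 0 and b₀^ε has zero average; (ii) the points A = (0, π/2) and B = (π, επ + π/2) are zeros of b₀^ε at which the differential of b₀^ε is invertible; (iii) ψ₀^ε vanishes identically on the line {(s, εs + π/2) : s ∈ ℝ}, which is an invariant curve of b₀^ε connecting A and B; (iv) Δψ₀^ε(A) = 2εM and Δψ₀^ε(B) = −2εM, so in particular Δψ₀^ε(A) ≠ Δψ₀^ε(B). -/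
open MeasureTheory Real Set

noncomputable section

/-- The stream function `ψ₀^ε(x) = M sin x₁ cos(x₂ - ε x₁)`. -/
def psi0eps (M ε : ℝ) : (Fin 2 → ℝ) → ℝ :=
  fun x => M * Real.sin (x 0) * Real.cos (x 1 - ε * x 0)

/-- The initial magnetic field for 2D instantaneous reconnection. -/
def b0eps (M ε : ℝ) : (Fin 2 → ℝ) → Fin 2 → ℝ := fun x =>
  ![-(M * Real.sin (x 0) * Real.sin (x 1 - ε * x 0)),
    -(M * ε * Real.sin (x 0) * Real.sin (x 1 - ε * x 0))
      - M * Real.cos (x 0) * Real.cos (x 1 - ε * x 0)]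

/-- The span of the products of `sin x₁`, `cos x₁` with `sin (x₂ - ε x₁)`, `cos (x₂ - ε x₁)`;
it is closed under partial derivatives. -/
def trigComb (ε a b c d : ℝ) : (Fin 2 → ℝ) → ℝ := fun x =>
  a * (Real.sin (x 0) * Real.sin (x 1 - ε * x 0))
    + b * (Real.sin (x 0) * Real.cos (x 1 - ε * x 0))
    + c * (Real.cos (x 0) * Real.sin (x 1 - ε * x 0))
    + d * (Real.cos (x 0) * Real.cos (x 1 - ε * x 0))

theorem hasFDerivAt_trigComb (ε a b c d : ℝ) (x : Fin 2 → ℝ) :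
    HasFDerivAt (trigComb ε a b c d)
      (trigComb ε (ε * b - c) (-(ε * a) - d) (a + ε * d) (b - ε * c) x
          • ContinuousLinearMap.proj (R := ℝ) (φ := fun _ : Fin 2 => ℝ) 0
        + trigComb ε (-b) a (-d) c x
          • ContinuousLinearMap.proj (R := ℝ) (φ := fun _ : Fin 2 => ℝ) 1) x := by
  have h0 : HasFDerivAt (fun y : Fin 2 → ℝ => y 0)
      (ContinuousLinearMap.proj (R := ℝ) (φ := fun _ : Fin 2 => ℝ) 0) x := hasFDerivAt_apply 0 x
  have h1 : HasFDerivAt (fun y : Fin 2 → ℝ => y 1)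
      (ContinuousLinearMap.proj (R := ℝ) (φ := fun _ : Fin 2 => ℝ) 1) x := hasFDerivAt_apply 1 x
  have hθ := h1.sub (h0.const_mul ε)
  have h := ((((h0.sin.mul hθ.sin).const_mul a).add ((h0.sin.mul hθ.cos).const_mul b)).add
    ((h0.cos.mul hθ.sin).const_mul c)).add ((h0.cos.mul hθ.cos).const_mul d)
  refine h.congr_fderiv ?_
  ext v
  simp [trigComb]
  ring

theorem pd_zero_trigComb (ε a b c d : ℝ) :
    pd 0 (trigComb ε a b c d)
      = trigComb ε (ε * b - c) (-(ε * a) - d) (a + ε * d) (b - ε * c) := by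
  funext x
  simp [pd, (hasFDerivAt_trigComb ε a b c d x).fderiv]

theorem pd_one_trigComb (ε a b c d : ℝ) :
    pd 1 (trigComb ε a b c d) = trigComb ε (-b) a (-d) c := by
  funext x
  simp [pd, (hasFDerivAt_trigComb ε a b c d x).fderiv]

theorem continuous_trigComb (ε a b c d : ℝ) : Continuous (trigComb ε a b c d) := by
  unfold trigComb
  fun_prop

theorem setIntegral_trigComb_box (ε a b c d : ℝ) :
    ∫ x in box 2 (2 * π), trigComb ε a b c d x = 0 := by
  have hpre : box 2 (2 * π) = (MeasurableEquiv.finTwoArrow (α := ℝ)) ⁻¹'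
      (Icc 0 (2 * π) ×ˢ Icc 0 (2 * π)) := by
    ext x
    simp only [box, Set.mem_Icc, Pi.le_def, Fin.forall_fin_two, Set.mem_preimage, Set.mem_prod,
      MeasurableEquiv.finTwoArrow, MeasurableEquiv.piFinTwo_apply, Pi.zero_apply]
    tauto
  have hint : ∫ x in box 2 (2 * π), trigComb ε a b c d x
      = ∫ p in Icc (0 : ℝ) (2 * π) ×ˢ Icc (0 : ℝ) (2 * π), trigComb ε a b c d ![p.1, p.2] := by
    rw [hpre, ← (volume_preserving_finTwoArrow ℝ).setIntegral_preimage_emb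
      (MeasurableEquiv.measurableEmbedding _)]
    congr 1
  have hcont : Continuous fun p : ℝ × ℝ => trigComb ε a b c d ![p.1, p.2] :=
    (continuous_trigComb ε a b c d).comp (by fun_prop)
  rw [hint, Measure.volume_eq_prod, setIntegral_prod _
    (hcont.continuousOn.integrableOn_compact (isCompact_Icc.prod isCompact_Icc))]
  have hinner : ∀ s : ℝ, ∫ t in Icc (0 : ℝ) (2 * π), trigComb ε a b c d ![s, t] = 0 := by
    intro s
    rw [integral_Icc_eq_integral_Ioc, ← intervalIntegral.integral_of_le two_pi_pos.le,
      intervalIntegral.integral_eq_sub_of_hasDerivAt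
        (f := fun t => trigComb ε b (-a) d (-c) ![s, t])]
    · simp [trigComb, sub_eq_neg_add, Real.sin_add_two_pi, Real.cos_add_two_pi]
    · intro t _
      have hθ := (hasDerivAt_id t).sub_const (ε * s)
      have h := ((((hθ.sin.const_mul (Real.sin s)).const_mul b).add
        ((hθ.cos.const_mul (Real.sin s)).const_mul (-a))).add
        ((hθ.sin.const_mul (Real.cos s)).const_mul d)).add
        ((hθ.cos.const_mul (Real.cos s)).const_mul (-c))
      refine h.congr_deriv ?_
      simp [trigComb]
      ring
    · exact (hcont.comp (by fun_prop : Continuous fun t : ℝ => (s, t))).intervalIntegrable _ _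
  simp [hinner]

theorem psi0eps_eq_trigComb (M ε : ℝ) : psi0eps M ε = trigComb ε 0 M 0 0 := by
  funext x
  simp [psi0eps, trigComb, mul_assoc]

theorem b0eps_zero_eq_trigComb (M ε : ℝ) :
    (fun x => b0eps M ε x 0) = trigComb ε (-M) 0 0 0 := by
  funext x
  simp [b0eps, trigComb, mul_assoc]

theorem b0eps_one_eq_trigComb (M ε : ℝ) :
    (fun x => b0eps M ε x 1) = trigComb ε (-(M * ε)) 0 0 (-M) := by
  funext x
  simp [b0eps, trigComb]
  ring

theorem fderiv_b0eps_apply (M ε : ℝ) (x v : Fin 2 → ℝ) :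
    fderiv ℝ (b0eps M ε) x v =
      ![trigComb ε 0 (ε * M) (-M) 0 x * v 0 + trigComb ε 0 (-M) 0 0 x * v 1,
        trigComb ε 0 (ε * (M * ε) + M) (-(M * ε) - ε * M) 0 x * v 0
          + trigComb ε 0 (-(M * ε)) M 0 x * v 1] := by
  have h0 := hasFDerivAt_trigComb ε (-M) 0 0 0 x
  have h1 := hasFDerivAt_trigComb ε (-(M * ε)) 0 0 (-M) x
  rw [← b0eps_zero_eq_trigComb] at h0
  rw [← b0eps_one_eq_trigComb] at h1
  have hd : DifferentiableAt ℝ (b0eps M ε) x := by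
    rw [differentiableAt_pi, Fin.forall_fin_two]
    exact ⟨h0.differentiableAt, h1.differentiableAt⟩
  have h := hasFDerivAt_pi'.1 hd.hasFDerivAt
  have e0 := congrArg (fun L => L v) ((h 0).unique h0)
  have e1 := congrArg (fun L => L v) ((h 1).unique h1)
  simp only [ContinuousLinearMap.comp_apply, ContinuousLinearMap.proj_apply,
    add_apply, smul_apply, smul_eq_mul] at e0 e1
  funext i
  fin_cases i
  · simpa [trigComb] using e0
  · simp [trigComb] at e1 ⊢
    linarith

theorem bijective_fderiv_b0eps {M ε : ℝ} {x : Fin 2 → ℝ} (hM : M ≠ 0)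
    (hsin : Real.sin (x 0) = 0) (hcos : Real.cos (x 1 - ε * x 0) = 0) :
    Function.Bijective (fderiv ℝ (b0eps M ε) x) := by
  have hc : Real.cos (x 0) ≠ 0 := by
    intro h
    simpa [hsin, h] using Real.sin_sq_add_cos_sq (x 0)
  have hs : Real.sin (x 1 - ε * x 0) ≠ 0 := by
    intro h
    simpa [hcos, h] using Real.sin_sq_add_cos_sq (x 1 - ε * x 0)
  have hinj : Function.Injective (fderiv ℝ (b0eps M ε) x : (Fin 2 → ℝ) →ₗ[ℝ] (Fin 2 → ℝ)) := by
    rw [injective_iff_map_eq_zero]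
    intro v hv
    have hv' : fderiv ℝ (b0eps M ε) x v = 0 := hv
    rw [fderiv_b0eps_apply] at hv'
    have h0 : v 0 = 0 := by simpa [trigComb, hsin, hcos, hM, hc, hs] using congrFun hv' 0
    have h1 : v 1 = 0 := by simpa [trigComb, hsin, hcos, hM, hc, hs, h0] using congrFun hv' 1
    funext i
    fin_cases i
    · exact h0
    · exact h1
  exact ⟨hinj, LinearMap.surjective_of_injective hinj⟩

/-- the initial field for 2D instantaneous reconnection:
`b₀^ε = ∇⊥ψ₀^ε` is divergence free with zero average; `A = (0, π/2)` and
`B = (π, επ + π/2)` are non-degenerate zeros of `b₀^ε`; `ψ₀^ε` vanishes on the invariant line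
`{(s, εs + π/2)}` joining `A` and `B` (to which `b₀^ε` is tangent); and
`Δψ₀^ε(A) = 2εM ≠ -2εM = Δψ₀^ε(B)`. -/
theorem initial_field_2d_instantaneous (M ε : ℝ) (hM : 0 < M) (hε0 : 0 < ε) (hε1 : ε < 1) :
    (∀ x : Fin 2 → ℝ,
      b0eps M ε x 0 = pd 1 (psi0eps M ε) x ∧ b0eps M ε x 1 = -pd 0 (psi0eps M ε) x) ∧
    (∀ x, divg (b0eps M ε) x = 0) ∧
    ZeroAvg (2 * π) (b0eps M ε) ∧
    b0eps M ε ![0, π / 2] = 0 ∧ b0eps M ε ![π, ε * π + π / 2] = 0 ∧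
    Function.Bijective (fderiv ℝ (b0eps M ε) ![0, π / 2]) ∧
    Function.Bijective (fderiv ℝ (b0eps M ε) ![π, ε * π + π / 2]) ∧
    (∀ s : ℝ, psi0eps M ε ![s, ε * s + π / 2] = 0 ∧
      b0eps M ε ![s, ε * s + π / 2] 1 = ε * b0eps M ε ![s, ε * s + π / 2] 0) ∧
    (![(0 : ℝ), π / 2] : Fin 2 → ℝ) = ![(0 : ℝ), ε * 0 + π / 2] ∧
    (![π, ε * π + π / 2] : Fin 2 → ℝ) = ![π, ε * π + π / 2] ∧
    pd 0 (pd 0 (psi0eps M ε)) ![0, π / 2] + pd 1 (pd 1 (psi0eps M ε)) ![0, π / 2]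
      = 2 * ε * M ∧
    pd 0 (pd 0 (psi0eps M ε)) ![π, ε * π + π / 2]
        + pd 1 (pd 1 (psi0eps M ε)) ![π, ε * π + π / 2]
      = -(2 * ε * M) ∧
    pd 0 (pd 0 (psi0eps M ε)) ![0, π / 2] + pd 1 (pd 1 (psi0eps M ε)) ![0, π / 2]
      ≠ pd 0 (pd 0 (psi0eps M ε)) ![π, ε * π + π / 2]
        + pd 1 (pd 1 (psi0eps M ε)) ![π, ε * π + π / 2] := by
  have hA : pd 0 (pd 0 (psi0eps M ε)) ![0, π / 2] + pd 1 (pd 1 (psi0eps M ε)) ![0, π / 2]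
      = 2 * ε * M := by
    simp [psi0eps_eq_trigComb, pd_zero_trigComb, pd_one_trigComb, trigComb]
    ring
  have hB : pd 0 (pd 0 (psi0eps M ε)) ![π, ε * π + π / 2]
        + pd 1 (pd 1 (psi0eps M ε)) ![π, ε * π + π / 2] = -(2 * ε * M) := by
    simp [psi0eps_eq_trigComb, pd_zero_trigComb, pd_one_trigComb, trigComb]
    ring
  refine ⟨fun x => ⟨?_, ?_⟩, fun x => ?_, fun i => ?_, ?_, ?_, ?_, ?_, fun s => ⟨?_, ?_⟩, ?_, rfl,
    hA, hB, ?_⟩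
  · simp [psi0eps_eq_trigComb, pd_one_trigComb, b0eps, trigComb, mul_assoc]
  · simp [psi0eps_eq_trigComb, pd_zero_trigComb, b0eps, trigComb]
    ring
  · simp only [divg, Fin.sum_univ_two, b0eps_zero_eq_trigComb, b0eps_one_eq_trigComb,
      pd_zero_trigComb, pd_one_trigComb, trigComb]
    ring
  · fin_cases i
    · exact (congrArg (fun f => ∫ x in box 2 (2 * π), f x) (b0eps_zero_eq_trigComb M ε)).trans
        (setIntegral_trigComb_box _ _ _ _ _)
    · exact (congrArg (fun f => ∫ x in box 2 (2 * π), f x) (b0eps_one_eq_trigComb M ε)).trans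
        (setIntegral_trigComb_box _ _ _ _ _)
  · funext i
    fin_cases i <;> simp [b0eps]
  · funext i
    fin_cases i <;> simp [b0eps]
  · exact bijective_fderiv_b0eps hM.ne' (by simp) (by simp)
  · exact bijective_fderiv_b0eps hM.ne' (by simp) (by simp)
  · simp [psi0eps]
  · simp [b0eps]
    ring
  · simp
  · rw [hA, hB]
    have := mul_pos hε0 hM
    linarith

end
end
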